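/- arXiv:2401.08312 — 2 statements merged into one kernel-verified Lean document; each statement's English description precedes it below -/
import Mathlib

section
/- Assume b_j − a_j ∈ ℤ_{≥0} for every j and b_i − b_j ∉ ℤ whenever i ≠ j. Then for every multi-index n ∈ ℕ^r near the diagonal the weights form an AT-system on (0,1): for any real polynomials A_1, …, A_r with deg A_j ≤ n_j − 1, not all zero, the function F(x) = Σ_{j=1}^r A_j(x) w_j(x) has at most |n| − 1 zeros in the open interval (0,1). -/
open MeasureTheory Finset

/-- The derivative of `∑ c, f c * exp ((c - d) * t)` in `t`, up to a nonvanishing factor. -/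
lemma hasDerivAt_sum_mul_exp (C : Finset ℝ) (f : ℝ → ℝ) (d t : ℝ) :
    HasDerivAt (fun t => ∑ c ∈ C, f c * Real.exp ((c - d) * t))
      (Real.exp (-d * t) * ∑ c ∈ C, f c * (c - d) * Real.exp (c * t)) t := by
  have h : ∀ c ∈ C, HasDerivAt (fun t => f c * Real.exp ((c - d) * t))
      (f c * (Real.exp ((c - d) * t) * ((c - d) * 1))) t := fun c _ =>
    (((hasDerivAt_id t).const_mul (c - d)).exp).const_mul (f c)
  refine (HasDerivAt.fun_sum h).congr_deriv ?_
  rw [mul_sum]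
  refine sum_congr rfl fun c _ => ?_
  rw [show (c - d) * t = -d * t + c * t by ring, Real.exp_add]
  ring

/-- Rolle's theorem for a finite set of zeros of an exponential sum. -/
lemma exists_finset_zeros_of_exp_sum (C : Finset ℝ) (f : ℝ → ℝ) (d : ℝ) (S : Finset ℝ)
    (hS : ∀ t ∈ S, t ≤ 0 ∧ ∑ c ∈ C, f c * Real.exp (c * t) = 0) :
    ∃ T : Finset ℝ, S.card ≤ T.card + 1 ∧
      ∀ t ∈ T, t < 0 ∧ ∑ c ∈ C, f c * (c - d) * Real.exp (c * t) = 0 := by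
  have hzero : ∀ t ∈ S, ∑ c ∈ C, f c * Real.exp ((c - d) * t) = 0 := fun t ht => by
    have : ∑ c ∈ C, f c * Real.exp ((c - d) * t)
        = Real.exp (-d * t) * ∑ c ∈ C, f c * Real.exp (c * t) := by
      rw [mul_sum]
      refine sum_congr rfl fun c _ => ?_
      rw [show (c - d) * t = -d * t + c * t by ring, Real.exp_add]
      ring
    rw [this, (hS t ht).2, mul_zero]
  have hrolle : ∀ x ∈ S, ∀ y ∈ S, x < y → ∃ z, x < z ∧ z < y ∧
      ∑ c ∈ C, f c * (c - d) * Real.exp (c * z) = 0 := fun x hx y hy hxy => by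
    obtain ⟨z, hz, hz0⟩ := exists_hasDerivAt_eq_zero hxy
      (fun t _ => (hasDerivAt_sum_mul_exp C f d t).continuousAt.continuousWithinAt)
      ((hzero x hx).trans (hzero y hy).symm) (fun t _ => hasDerivAt_sum_mul_exp C f d t)
    exact ⟨z, hz.1, hz.2, (mul_eq_zero.mp hz0).resolve_left (Real.exp_pos _).ne'⟩
  choose! z hz using hrolle
  refine ⟨((S ×ˢ S).filter fun p => p.1 < p.2).image fun p => z p.1 p.2, ?_, ?_⟩
  · refine card_le_of_interleaved fun x hx y hy hxy _ => ?_
    exact ⟨z x y, mem_image.mpr ⟨(x, y), by simp [hx, hy, hxy], rfl⟩,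
      (hz x hx y hy hxy).1, (hz x hx y hy hxy).2.1⟩
  · intro t ht
    obtain ⟨p, hp, rfl⟩ := mem_image.mp ht
    simp only [mem_filter, mem_product] at hp
    obtain ⟨_, h2, h3⟩ := hz p.1 hp.1.1 p.2 hp.1.2 hp.2
    exact ⟨h2.trans_le (hS _ hp.1.2).1, h3⟩

/-- A nonzero exponential sum with a zero of order at least `m` at the origin has fewer than
`#C - m` zeros on the negative half-line. -/
lemma card_zeros_exp_sum_lt (C : Finset ℝ) : ∀ (f : ℝ → ℝ) (m : ℕ) (S : Finset ℝ), C.Nonempty →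
    (∀ c ∈ C, f c ≠ 0) → (∀ i < m, ∑ c ∈ C, f c * c ^ i = 0) →
    (∀ t ∈ S, t < 0 ∧ ∑ c ∈ C, f c * Real.exp (c * t) = 0) → S.card + m < C.card := by
  induction C using Finset.induction_on with
  | empty => intro f m S h; simp at h
  | insert d C hd ih =>
    intro f m S _ hf hm hS
    rcases C.eq_empty_or_nonempty with rfl | hC
    · have hfd : f d ≠ 0 := hf d (by simp)
      have hm0 : m = 0 := by
        by_contra h
        exact hfd (by simpa using hm 0 (Nat.pos_of_ne_zero h))
      have hS0 : S = ∅ := eq_empty_of_forall_notMem fun t ht => hfd (by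
        simpa [Real.exp_ne_zero] using (hS t ht).2)
      simp [hm0, hS0]
    have hf' : ∀ c ∈ C, f c * (c - d) ≠ 0 := fun c hc =>
      mul_ne_zero (hf c (mem_insert_of_mem hc)) (sub_ne_zero.mpr fun h => hd (h ▸ hc))
    have hmom : ∀ i, i + 1 < m → ∑ c ∈ C, f c * (c - d) * c ^ i = 0 := fun i hi => by
      have h1 := hm (i + 1) hi
      have h0 := hm i (by omega)
      have : ∑ c ∈ insert d C, f c * (c - d) * c ^ i = 0 := by
        calc _ = ∑ c ∈ insert d C, f c * c ^ (i + 1) - d * ∑ c ∈ insert d C, f c * c ^ i := by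
              rw [mul_sum, ← sum_sub_distrib]
              exact sum_congr rfl fun c _ => by ring
          _ = 0 := by rw [h1, h0]; ring
      simpa [sum_insert hd] using this
    have hins : ∀ t, ∑ c ∈ insert d C, f c * (c - d) * Real.exp (c * t)
        = ∑ c ∈ C, f c * (c - d) * Real.exp (c * t) := fun t => by simp [sum_insert hd]
    rw [card_insert_of_notMem hd]
    rcases m with _ | m
    · obtain ⟨T, hcard, hT⟩ := exists_finset_zeros_of_exp_sum (insert d C) f d S
        fun t ht => ⟨(hS t ht).1.le, (hS t ht).2⟩
      have := ih (fun c => f c * (c - d)) 0 T hC hf' (by simp)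
        fun t ht => ⟨(hT t ht).1, (hins t).symm.trans (hT t ht).2⟩
      omega
    · have h0 : (0 : ℝ) ∉ S := fun h => (hS 0 h).1.false
      obtain ⟨T, hcard, hT⟩ := exists_finset_zeros_of_exp_sum (insert d C) f d (insert 0 S)
        fun t ht => by
          rcases mem_insert.mp ht with rfl | ht
          · simpa using hm 0 (by omega)
          · exact ⟨(hS t ht).1.le, (hS t ht).2⟩
      have := ih (fun c => f c * (c - d)) m T hC hf' (fun i hi => hmom i (by omega))
        fun t ht => ⟨(hT t ht).1, (hins t).symm.trans (hT t ht).2⟩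
      rw [card_insert_of_notMem h0] at hcard
      omega

/-- A nonzero combination `∑ c, f c * x ^ c` of real powers with a zero of order at least `m`
at `1` has fewer than `#f.support - m` zeros in `(0, 1)`. -/
lemma card_zeros_rpow_sum_lt (f : ℝ →₀ ℝ) (hf : f ≠ 0) (m : ℕ)
    (hm : ∀ i < m, Finsupp.linearCombination ℝ (fun c : ℝ => c ^ i) f = 0) (S : Finset ℝ)
    (hS : ∀ x ∈ S, x ∈ Set.Ioo (0 : ℝ) 1 ∧
      Finsupp.linearCombination ℝ (fun c : ℝ => x ^ c) f = 0) :
    S.card + m < f.support.card := by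
  have hinj : Set.InjOn Real.log S :=
    Real.log_injOn_pos.mono fun x hx => (hS x hx).1.1
  rw [← card_image_of_injOn hinj]
  refine card_zeros_exp_sum_lt f.support f m _ (Finsupp.support_nonempty_iff.mpr hf)
    (fun c hc => Finsupp.mem_support_iff.mp hc)
    (fun i hi => by simpa [Finsupp.linearCombination_apply, Finsupp.sum] using hm i hi) ?_
  intro t ht
  obtain ⟨x, hx, rfl⟩ := mem_image.mp ht
  obtain ⟨hx01, hx0⟩ := hS x hx
  refine ⟨Real.log_neg hx01.1 hx01.2, ?_⟩
  rw [Finsupp.linearCombination_apply, Finsupp.sum] at hx0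
  rw [← hx0]
  refine sum_congr rfl fun c _ => ?_
  rw [Real.rpow_def_of_pos hx01.1, smul_eq_mul, mul_comm c]

/-- A function on `(0, 1)` is determined by its moments. -/
lemma eqOn_zero_of_forall_moment_eq_zero {h : ℝ → ℝ} (hc : ContinuousOn h (Set.Ioo 0 1))
    (hi : IntegrableOn h (Set.Ioo 0 1))
    (hmom : ∀ n : ℕ, ∫ x in Set.Ioo (0 : ℝ) 1, x ^ n * h x = 0) :
    Set.EqOn h 0 (Set.Ioo 0 1) := by
  have hmul : ∀ φ : ℝ → ℝ, Continuous φ → IntegrableOn (fun x => φ x * h x) (Set.Ioo 0 1) := by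
    intro φ hφ
    obtain ⟨M, hM⟩ := isCompact_Icc.exists_bound_of_continuousOn (s := Set.Icc (0 : ℝ) 1)
      hφ.continuousOn
    refine Integrable.bdd_mul (c := M) hi hφ.aestronglyMeasurable ?_
    exact (ae_restrict_iff' measurableSet_Ioo).mpr
      (.of_forall fun x hx => hM x (Set.Ioo_subset_Icc_self hx))
  have hpoly : ∀ p : Polynomial ℝ, ∫ x in Set.Ioo (0 : ℝ) 1, p.eval x * h x = 0 := by
    intro p
    simp_rw [Polynomial.eval_eq_sum_range, sum_mul, mul_assoc]
    rw [integral_finsetSum _ fun i _ => (hmul (fun x => x ^ i) (by fun_prop)).const_mul _]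
    simp [integral_const_mul, hmom]
  have hcont : ∀ φ : ℝ → ℝ, Continuous φ → ∫ x in Set.Ioo (0 : ℝ) 1, φ x * h x = 0 := by
    intro φ hφ
    set I := ∫ x in Set.Ioo (0 : ℝ) 1, ‖h x‖ with hI
    have hI0 : 0 ≤ I := integral_nonneg fun _ => norm_nonneg _
    refine norm_le_zero_iff.mp (le_of_forall_pos_le_add fun ε hε => ?_)
    obtain ⟨p, hp⟩ := exists_polynomial_near_of_continuousOn 0 1 φ hφ.continuousOn
      (ε / (I + 1)) (by positivity)
    have hsub : ∫ x in Set.Ioo (0 : ℝ) 1, φ x * h x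
        = ∫ x in Set.Ioo (0 : ℝ) 1, (φ x - p.eval x) * h x := by
      simp_rw [sub_mul]
      rw [integral_sub (hmul φ hφ) (hmul _ p.continuous), hpoly, sub_zero]
    calc ‖∫ x in Set.Ioo (0 : ℝ) 1, φ x * h x‖
        ≤ ∫ x in Set.Ioo (0 : ℝ) 1, ε / (I + 1) * ‖h x‖ := by
          rw [hsub]
          refine norm_integral_le_of_norm_le (hi.norm.const_mul _) ?_
          refine (ae_restrict_iff' measurableSet_Ioo).mpr (.of_forall fun x hx => ?_)
          rw [norm_mul, Real.norm_eq_abs (_ - _), abs_sub_comm]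
          gcongr
          exact (hp x (Set.Ioo_subset_Icc_self hx)).le
      _ = ε * (I / (I + 1)) := by rw [integral_const_mul]; ring
      _ ≤ ε * 1 := by gcongr; exact (div_le_one (by positivity)).mpr (by linarith)
      _ = 0 + ε := by ring
  refine Measure.eqOn_open_of_ae_eq (μ := volume) ?_ isOpen_Ioo hc continuousOn_const
  refine (ae_restrict_iff' measurableSet_Ioo).mpr ?_
  refine isOpen_Ioo.ae_eq_zero_of_integral_contDiff_smul_eq_zero hi.locallyIntegrableOn
    fun g hg _ hsupp => ?_
  rw [← setIntegral_eq_integral_of_forall_compl_eq_zero (s := Set.Ioo (0 : ℝ) 1)]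
  · exact hcont g hg.continuous
  · intro x hx
    simp [image_eq_zero_of_notMem_tsupport fun h => hx (hsupp h)]

/-- Partial fractions for `∏ i, 1 / (x - v i)`. -/
lemma sum_nodalWeight_mul_inv_sub {ι : Type*} [DecidableEq ι] {s : Finset ι} {v : ι → ℝ}
    (hv : Set.InjOn v s) (hs : s.Nonempty) {x : ℝ} (hx : ∀ i ∈ s, x ≠ v i) :
    ∑ i ∈ s, Lagrange.nodalWeight s v i * (x - v i)⁻¹ = (∏ i ∈ s, (x - v i))⁻¹ := by
  have h := Lagrange.eval_interpolate_not_at_node (r := 1) hx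
  rw [Lagrange.interpolate_one hv hs, Lagrange.eval_nodal] at h
  refine eq_inv_of_mul_eq_one_right ?_
  simpa using h.symm

/-- Divided differences kill polynomials of low degree. -/
lemma sum_nodalWeight_mul_eval_eq_zero {ι : Type*} [DecidableEq ι] {s : Finset ι} {v : ι → ℝ}
    (hv : Set.InjOn v s) {P : Polynomial ℝ} (hP : P.natDegree + 1 < s.card) :
    ∑ i ∈ s, Lagrange.nodalWeight s v i * P.eval (v i) = 0 := by
  have h := Lagrange.coeff_eq_sum hv (P := P)
    (Polynomial.degree_le_natDegree.trans_lt (by exact_mod_cast (by omega)))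
  rw [Polynomial.coeff_eq_zero_of_natDegree_lt (by omega)] at h
  rw [h]
  refine sum_congr rfl fun i _ => ?_
  rw [Lagrange.nodalWeight, prod_inv_distrib]
  ring

lemma integrableOn_Ioo_rpow {c : ℝ} (hc : -1 < c) :
    IntegrableOn (fun x : ℝ => x ^ c) (Set.Ioo 0 1) :=
  (intervalIntegrable_iff_integrableOn_Ioo_of_le zero_le_one).mp
    (intervalIntegral.intervalIntegrable_rpow' hc)

lemma integral_Ioo_rpow {c : ℝ} (hc : -1 < c) :
    ∫ x in Set.Ioo (0 : ℝ) 1, x ^ c = (c + 1)⁻¹ := by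
  rw [← integral_Ioc_eq_integral_Ioo, ← intervalIntegral.integral_of_le zero_le_one,
    integral_rpow (Or.inl hc), Real.zero_rpow (by linarith)]
  simp

/-- A function on `(0, 1)` whose Mellin transform is `∏ i, 1 / (s + e i)` with distinct `e i` is
a combination of the powers `x ^ e i`. -/
lemma eq_sum_rpow_of_mellin {ι : Type*} [DecidableEq ι] {s : Finset ι} {e : ι → ℝ}
    (he : Set.InjOn e s) (hs : s.Nonempty) (he1 : ∀ i ∈ s, -1 < e i) {g : ℝ → ℝ}
    (hg : ContinuousOn g (Set.Ioo 0 1))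
    (hgi : IntegrableOn (fun x : ℝ => x * g x) (Set.Ioo 0 1))
    (hgm : ∀ t : ℝ, 1 < t →
      ∫ x in Set.Ioo (0 : ℝ) 1, x ^ (t - 1) * g x = (∏ i ∈ s, (t + e i))⁻¹)
    {x : ℝ} (hx : x ∈ Set.Ioo (0 : ℝ) 1) :
    g x = ∑ i ∈ s, Lagrange.nodalWeight s (fun i => -e i) i * x ^ e i := by
  set ρ := Lagrange.nodalWeight s (fun i => -e i)
  have hpow : ∀ n : ℕ, ∀ i ∈ s, -1 < e i + 1 + n := fun n i hi => by
    linarith [he1 i hi, n.cast_nonneg (α := ℝ)]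
  have hzero : Set.EqOn (fun x => x * g x - ∑ i ∈ s, ρ i * x ^ (e i + 1)) 0 (Set.Ioo 0 1) := by
    have hGc : ContinuousOn (fun x : ℝ => ∑ i ∈ s, ρ i * x ^ (e i + 1)) (Set.Ioo 0 1) :=
      continuousOn_finsetSum _ fun i _ => continuousOn_const.mul
        (continuousOn_id.rpow_const fun x hx => Or.inl hx.1.ne')
    have hGi : IntegrableOn (fun x : ℝ => ∑ i ∈ s, ρ i * x ^ (e i + 1)) (Set.Ioo 0 1) :=
      integrable_finsetSum _ fun i hi =>
        (integrableOn_Ioo_rpow (by simpa using hpow 0 i hi)).const_mul _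
    refine eqOn_zero_of_forall_moment_eq_zero ((continuousOn_id.mul hg).sub hGc)
      (hgi.sub hGi) fun n => ?_
    have hsplit : ∀ x ∈ Set.Ioo (0 : ℝ) 1, x ^ n * (x * g x - ∑ i ∈ s, ρ i * x ^ (e i + 1))
        = x ^ ((n + 2 : ℝ) - 1) * g x - ∑ i ∈ s, ρ i * x ^ (e i + 1 + n) := fun x hx => by
      have h1 : x ^ ((n + 2 : ℝ) - 1) = x ^ n * x := by
        rw [show (n + 2 : ℝ) - 1 = ((n + 1 : ℕ) : ℝ) by push_cast; ring, Real.rpow_natCast,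
          pow_succ]
      rw [h1, mul_sub, mul_sum, mul_assoc]
      congr 1
      refine sum_congr rfl fun i _ => ?_
      rw [Real.rpow_add_natCast hx.1.ne']
      ring
    have hgn : IntegrableOn (fun x : ℝ => x ^ ((n + 2 : ℝ) - 1) * g x) (Set.Ioo 0 1) := by
      refine IntegrableOn.congr_fun (f := fun x => x ^ n * (x * g x)) ?_ (fun x hx => ?_)
        measurableSet_Ioo
      · refine Integrable.bdd_mul (c := 1) hgi (by fun_prop) ?_
        refine (ae_restrict_iff' measurableSet_Ioo).mpr (.of_forall fun x hx => ?_)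
        rw [norm_pow, Real.norm_of_nonneg hx.1.le]
        exact pow_le_one₀ hx.1.le hx.2.le
      · dsimp only
        rw [show (n + 2 : ℝ) - 1 = ((n + 1 : ℕ) : ℝ) by push_cast; ring, Real.rpow_natCast]
        ring
    have hterm : ∀ i ∈ s, IntegrableOn (fun x : ℝ => ρ i * x ^ (e i + 1 + n)) (Set.Ioo 0 1) :=
      fun i hi => (integrableOn_Ioo_rpow (hpow n i hi)).const_mul _
    rw [setIntegral_congr_fun measurableSet_Ioo hsplit,
      integral_sub hgn (integrable_finsetSum _ hterm), integral_finsetSum _ hterm,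
      hgm _ (by linarith [n.cast_nonneg (α := ℝ)]), sub_eq_zero]
    have hpf := sum_nodalWeight_mul_inv_sub (v := fun i => -e i) (x := (n + 2 : ℝ))
      (fun i hi j hj h => he hi hj (neg_injective h)) hs fun i hi h => by
        have := hpow n i hi
        linarith
    simp only [sub_neg_eq_add] at hpf
    rw [← hpf]
    refine sum_congr rfl fun i hi => ?_
    rw [integral_const_mul, integral_Ioo_rpow (hpow n i hi)]
    congr 2
    ring
  have h := hzero hx
  simp only [Pi.zero_apply, sub_eq_zero] at h
  refine mul_left_cancel₀ hx.1.ne' (h.trans ?_)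
  rw [mul_sum]
  refine sum_congr rfl fun i _ => ?_
  rw [Real.rpow_add_one hx.1.ne']
  ring

lemma Gamma_add_nat_eq_prod {x : ℝ} (hx : 0 < x) (k : ℕ) :
    Real.Gamma (x + k) = (∏ l ∈ range k, (x + l)) * Real.Gamma x := by
  induction k with
  | zero => simp
  | succ k ih =>
    rw [Nat.cast_succ, ← add_assoc, Real.Gamma_add_one (by positivity), ih, prod_range_succ]
    ring

/-- The index set `{(i, l) : l < k i}` of the exponents `a i + l`. -/
def exponentIndex {r : ℕ} (k : Fin r → ℕ) : Finset (Σ _ : Fin r, ℕ) :=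
  univ.sigma fun i => range (k i)

lemma mem_exponentIndex {r : ℕ} {k : Fin r → ℕ} {p : Σ _ : Fin r, ℕ} :
    p ∈ exponentIndex k ↔ p.2 < k p.1 := by
  simp [exponentIndex]

lemma card_exponentIndex {r : ℕ} (k : Fin r → ℕ) : (exponentIndex k).card = ∑ i, k i := by
  simp [exponentIndex]

lemma prod_Gamma_div_prod_Gamma {r : ℕ} {a : Fin r → ℝ} {t : ℝ} (ht : ∀ i, 0 < t + a i)
    (k : Fin r → ℕ) :
    (∏ i, Real.Gamma (t + a i)) / ∏ i, Real.Gamma (t + a i + k i)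
      = (∏ p ∈ exponentIndex k, (t + (a p.1 + p.2)))⁻¹ := by
  simp_rw [fun i => Gamma_add_nat_eq_prod (ht i) (k i), prod_mul_distrib]
  have hG : ∏ i, Real.Gamma (t + a i) ≠ 0 :=
    prod_ne_zero_iff.mpr fun i _ => (Real.Gamma_pos_of_pos (ht i)).ne'
  rw [exponentIndex, prod_sigma, div_mul_cancel_right₀ hG]
  simp only [add_assoc]

/-- Under the conditions `b j - a j ∈ ℤ_{≥0}` and `b i - b j ∉ ℤ` for `i ≠ j`,
the Jacobi-like weights form an AT-system on (0,1) for every multi-index near the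
diagonal: a nonzero polynomial combination `F(x) = ∑ j, A j (x) * w j (x)` with
`deg A j ≤ n j - 1` has at most `|n| - 1` zeros in `(0,1)`. -/
theorem stmt_2
    (r : ℕ) (hr : 1 ≤ r)
    (a b : Fin r → ℝ)
    (ha : ∀ i, -1 < a i) (hb : ∀ i, -1 < b i) (hab : ∀ i, a i < b i)
    (w : Fin r → ℝ → ℝ)
    (hw_cont : ∀ j, ContinuousOn (w j) (Set.Ioo 0 1))
    (hw_int : ∀ j, ∀ σ : ℝ, 0 < σ →
      IntegrableOn (fun x : ℝ => x ^ (σ - 1) * |w j x|) (Set.Ioo 0 1))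
    (hw_mellin : ∀ j, ∀ s : ℝ, 1 < s →
      ∫ x in Set.Ioo (0:ℝ) 1, x ^ (s - 1) * w j x
        = (∏ i, Real.Gamma (s + a i)) /
          (∏ i, Real.Gamma (s + b i + if i = j then 1 else 0)))
    (hba : ∀ j, ∃ k : ℕ, b j - a j = k)
    (hbb : ∀ i j, i ≠ j → ∀ k : ℤ, b i - b j ≠ k)
    (n : Fin r → ℕ)
    (hn : ∀ i j, |(n i : ℤ) - (n j : ℤ)| ≤ 1)
    (A : Fin r → Polynomial ℝ)
    (hA : ∀ j, (A j).degree < (n j : WithBot ℕ))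
    (hA0 : ∃ j, A j ≠ 0) :
    ∀ S : Finset ℝ,
      (∀ x ∈ S, x ∈ Set.Ioo (0:ℝ) 1 ∧ (∑ j, (A j).eval x * w j x) = 0) →
      S.card ≤ (∑ j, n j) - 1 := by
  intro S hS
  choose k hk using hba
  have hb_eq : ∀ i, b i = a i + k i := fun i => by linarith [hk i]
  set e : (Σ _ : Fin r, ℕ) → ℝ := fun p => a p.1 + p.2 with he_def
  have he : Function.Injective e := by
    rintro ⟨i, l⟩ ⟨j, m⟩ h
    simp only [he_def] at h
    by_cases hij : i = j
    · subst hij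
      simpa using h
    · refine absurd ?_ (hbb i j hij (m + k i - l - k j))
      rw [hb_eq, hb_eq]
      push_cast
      linarith
  have he1 : ∀ p, -1 < e p := fun p => by
    have := ha p.1
    have := p.2.cast_nonneg (α := ℝ)
    simp only [he_def]
    linarith
  set K : Fin r → Fin r → ℕ := fun j i => k i + if i = j then 1 else 0 with hK
  set P : Fin r → Finset (Σ _ : Fin r, ℕ) := fun j => exponentIndex (K j) with hP
  set ρ : Fin r → (Σ _ : Fin r, ℕ) → ℝ :=
    fun j => Lagrange.nodalWeight (P j) (fun p => -e p) with hρ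
  have hP_top : ∀ j, (⟨j, k j⟩ : Σ _ : Fin r, ℕ) ∈ P j := fun j => by
    simp [hP, hK, mem_exponentIndex]
  have hP_card : ∀ j, (P j).card = ∑ i, k i + 1 := fun j => by
    simp [hP, hK, card_exponentIndex, sum_add_distrib]
  have hv : ∀ j, Set.InjOn (fun p => -e p) (P j) := fun j =>
    (neg_injective.comp he).injOn
  have hw : ∀ j, ∀ x ∈ Set.Ioo (0 : ℝ) 1, w j x = ∑ p ∈ P j, ρ j p * x ^ e p := by
    intro j x hx
    refine eq_sum_rpow_of_mellin he.injOn ⟨_, hP_top j⟩ (fun p _ => he1 p) (hw_cont j) ?_ ?_ hx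
    · have hc : ContinuousOn (fun x => x * w j x) (Set.Ioo 0 1) :=
        continuousOn_id.mul (hw_cont j)
      refine (hw_int j 2 two_pos).mono' (hc.aestronglyMeasurable measurableSet_Ioo) ?_
      refine (ae_restrict_iff' measurableSet_Ioo).mpr (.of_forall fun x hx => ?_)
      rw [norm_mul, Real.norm_of_nonneg hx.1.le, Real.norm_eq_abs,
        show (2 : ℝ) - 1 = 1 by norm_num, Real.rpow_one]
    · intro t ht
      rw [hw_mellin j t ht, ← prod_Gamma_div_prod_Gamma (fun i => by linarith [ha i])]
      congr 1
      refine prod_congr rfl fun i _ => ?_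
      congr 1
      rw [hb_eq]
      simp only [hK]
      push_cast
      ring
  set f : ℝ →₀ ℝ := ∑ j, ∑ i ∈ range (n j), ∑ p ∈ P j,
    Finsupp.single (e p + i) ((A j).coeff i * ρ j p) with hf
  have hfsum : ∀ φ : ℝ → ℝ, Finsupp.linearCombination ℝ φ f
      = ∑ j, ∑ i ∈ range (n j), (A j).coeff i * ∑ p ∈ P j, ρ j p * φ (e p + i) := fun φ => by
    simp only [hf, map_sum, Finsupp.linearCombination_single, smul_eq_mul, mul_sum, mul_assoc]
  have hfx : ∀ x ∈ Set.Ioo (0 : ℝ) 1, Finsupp.linearCombination ℝ (fun c : ℝ => x ^ c) f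
      = ∑ j, (A j).eval x * w j x := by
    intro x hx
    rw [hfsum]
    refine sum_congr rfl fun j _ => ?_
    rcases eq_or_ne (A j) 0 with h0 | h0
    · simp [h0]
    rw [Polynomial.eval_eq_sum_range' ((Polynomial.natDegree_lt_iff_degree_lt h0).mpr (hA j)),
      sum_mul, hw j x hx]
    refine sum_congr rfl fun i _ => ?_
    rw [mul_sum, mul_sum]
    refine sum_congr rfl fun p _ => ?_
    rw [Real.rpow_add_natCast hx.1.ne']
    ring
  have hfm : ∀ q < ∑ i, k i, Finsupp.linearCombination ℝ (fun c : ℝ => c ^ q) f = 0 := by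
    intro q hq
    rw [hfsum]
    refine sum_eq_zero fun j _ => sum_eq_zero fun i _ => mul_eq_zero_of_right _ ?_
    have h := sum_nodalWeight_mul_eval_eq_zero (hv j)
      (P := (Polynomial.C (i : ℝ) - Polynomial.X) ^ q) ?_
    · simpa [add_comm] using h
    · have : ((Polynomial.C (i : ℝ) - Polynomial.X) ^ q).natDegree ≤ q := by
        compute_degree
      rw [hP_card]
      omega
  have hf_card : f.support.card ≤ ∑ i, (n i + k i) := by
    rw [← card_exponentIndex fun i => n i + k i]
    refine (card_le_card fun c hc => ?_).trans (card_image_le (f := e))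
    by_contra hcE
    refine Finsupp.mem_support_iff.mp hc ?_
    simp only [hf, Finsupp.finsetSum_apply]
    refine sum_eq_zero fun j _ => sum_eq_zero fun i hi => sum_eq_zero fun p hp =>
      Finsupp.single_eq_of_ne fun hcp => hcE (mem_image.mpr ⟨⟨p.1, p.2 + i⟩, ?_, ?_⟩)
    · have h1 := mem_exponentIndex.mp hp
      have h2 := mem_range.mp hi
      have h3 := abs_le.mp (hn j p.1)
      rw [mem_exponentIndex]
      simp only [hK] at h1 ⊢
      split_ifs at h1 with hj
      · rw [hj] at h1 ⊢
        omega
      · omega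
    · simp only [he_def] at hcp ⊢
      push_cast
      linarith
  have hf0 : f ≠ 0 := by
    obtain ⟨j, hj, hmax⟩ := exists_max_image (univ.filter fun j => A j ≠ 0)
      (fun j => (A j).natDegree) (by obtain ⟨j, hj⟩ := hA0; exact ⟨j, by simpa using hj⟩)
    simp only [mem_filter, mem_univ, true_and] at hj hmax
    have hd : (A j).natDegree < n j := (Polynomial.natDegree_lt_iff_degree_lt hj).mpr (hA j)
    intro hzero
    have h := DFunLike.congr_fun hzero (e ⟨j, k j⟩ + (A j).natDegree)
    have hval : f (e ⟨j, k j⟩ + (A j).natDegree)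
        = (A j).coeff (A j).natDegree * ρ j ⟨j, k j⟩ := by
      have key : ∀ l, ∀ i ∈ range (n l), ∀ p ∈ P l,
          (l = j ∧ i = (A j).natDegree ∧ p = ⟨j, k j⟩) ∨
          Finsupp.single (e p + i) ((A l).coeff i * ρ l p) (e ⟨j, k j⟩ + (A j).natDegree)
            = 0 := by
        intro l i hi p hp
        by_cases hc : (A l).coeff i = 0
        · right; simp [hc]
        by_cases hcp : e ⟨j, k j⟩ + (A j).natDegree = e p + i
        swap
        · right; exact Finsupp.single_eq_of_ne hcp
        left
        have hid : i ≤ (A j).natDegree := (Polynomial.le_natDegree_of_ne_zero hc).trans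
          (hmax l fun h0 => hc (by simp [h0]))
        have heq : (⟨j, k j + (A j).natDegree⟩ : Σ _ : Fin r, ℕ) = ⟨p.1, p.2 + i⟩ := he (by
          simp only [he_def] at hcp ⊢
          push_cast
          linarith)
        have hp' := mem_exponentIndex.mp hp
        obtain ⟨p1, p2⟩ := p
        simp only [Sigma.mk.injEq, heq_eq_eq] at heq hp' ⊢
        obtain ⟨rfl, h2⟩ := heq
        simp only [hK] at hp'
        split_ifs at hp' with hl
        · refine ⟨hl.symm, ?_, rfl, ?_⟩ <;> omega
        · omega
      simp only [hf, Finsupp.finsetSum_apply]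
      rw [sum_eq_single j, sum_eq_single (A j).natDegree, sum_eq_single ⟨j, k j⟩]
      · simp
      · exact fun p hp hne => (key j _ (mem_range.mpr hd) p hp).resolve_left fun h => hne h.2.2
      · exact fun h => absurd (hP_top j) h
      · exact fun i hi hne => sum_eq_zero fun p hp =>
          (key j i hi p hp).resolve_left fun h => hne h.2.1
      · exact fun h => absurd (mem_range.mpr hd) h
      · exact fun l _ hne => sum_eq_zero fun i hi => sum_eq_zero fun p hp =>
          (key l i hi p hp).resolve_left fun h => hne h.1
      · simp
    rw [hval] at h
    exact mul_ne_zero (by simpa using hj) (Lagrange.nodalWeight_ne_zero (hv j) (hP_top j)) h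
  have hlt := card_zeros_rpow_sum_lt f hf0 _ hfm S fun x hx =>
    ⟨(hS x hx).1, (hfx x (hS x hx).1).trans (hS x hx).2⟩
  rw [sum_add_distrib] at hf_card
  omega
end

section
/- Let 0 ≤ p < q be integers and let z ∈ ℚ, z ≠ 0. Then the q+1 real numbers 1 and T_j = Σ_{k=0}^∞ z^k / ((k+1)^j · (k!)^{q−p}), for j = 1, …, q, are linearly independent over ℚ. In particular, each T_j is irrational. -/
open Finset
open Polynomial

theorem sum_neg_one_pow_choose_eval_eq_zero {d : ℕ} {P : ℚ[X]} (hP : P.natDegree < d) (a : ℕ) :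
    ∑ i ∈ range (d + 1), (-1 : ℚ) ^ (d - i) * d.choose i * P.eval ((a + i : ℕ) : ℚ) = 0 := by
  have h := congrFun (Polynomial.fwdDiff_iter_eq_zero_of_degree_lt hP) (a : ℚ)
  rw [fwdDiff_iter_eq_sum_shift] at h
  rw [← h.trans (Pi.zero_apply _)]
  refine sum_congr rfl fun i _ ↦ ?_
  simp

theorem exists_degree_lt_and_eval_eq {d : ℕ} {v : ℕ → ℚ} (hv : Function.Injective v)
    (r : ℕ → ℚ) : ∃ P : ℚ[X], P.degree < d ∧ ∀ n < d, P.eval (v n) = r n := by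
  refine ⟨Lagrange.interpolate (range d) v r, ?_, fun n hn ↦
    Lagrange.eval_interpolate_at_node r hv.injOn (mem_range.2 hn)⟩
  simpa only [card_range] using
    Lagrange.degree_interpolate_lt (s := range d) (v := v) r hv.injOn

theorem exists_eval_eq_of_sum_choose_eq_zero {d T a : ℕ} {f : ℕ → ℚ}
    (h : ∀ t ≤ T, ∑ i ∈ range (d + 1), (-1 : ℚ) ^ (d - i) * d.choose i * f (a + t + i) = 0) :
    ∃ P : ℚ[X], P.degree < d ∧ ∀ n ≤ d + T, P.eval ((a + n : ℕ) : ℚ) = f (a + n) := by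
  obtain ⟨P, hdeg, hnode⟩ := exists_degree_lt_and_eval_eq (d := d) (v := fun i ↦ ((a + i : ℕ) : ℚ))
    (fun x y hxy ↦ by simpa using hxy) (fun i ↦ f (a + i))
  refine ⟨P, hdeg, fun n ↦ ?_⟩
  induction n using Nat.strong_induction_on with
  | _ n ih =>
    intro hn
    by_cases hnd : n < d
    · exact hnode n hnd
    obtain ⟨t, rfl⟩ := Nat.exists_eq_add_of_le (not_lt.1 hnd)
    rcases Nat.eq_zero_or_pos d with rfl | hd
    · have h0 : P = 0 := by
        rw [← Polynomial.degree_eq_bot]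
        simpa [Nat.WithBot.lt_zero_iff] using hdeg
      have := h t (by lia)
      simp at this
      simp [h0, this]
    have h1 := h t (by lia)
    have hnat : P.natDegree < d := by
      rcases eq_or_ne P 0 with rfl | hP
      · simpa using hd
      · exact (natDegree_lt_iff_degree_lt hP).2 hdeg
    have h2 := sum_neg_one_pow_choose_eval_eq_zero hnat (a + t)
    rw [sum_range_succ] at h1 h2
    have h3 : ∑ i ∈ range d, (-1 : ℚ) ^ (d - i) * d.choose i * P.eval ((a + t + i : ℕ) : ℚ) =
        ∑ i ∈ range d, (-1 : ℚ) ^ (d - i) * d.choose i * f (a + t + i) := by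
      refine sum_congr rfl fun i hi ↦ ?_
      have := mem_range.1 hi
      rw [add_assoc a, ih (t + i) (by lia) (by lia)]
    rw [h3] at h2
    rw [add_comm d t, ← add_assoc]
    simp only [Nat.sub_self, pow_zero, Nat.choose_self, Nat.cast_one, one_mul] at h1 h2
    linarith

theorem eq_zero_of_polynomial_recurrence {p q : ℕ} (hpq : p < q) {w : ℚ} (hw : w ≠ 0)
    {B : ℚ[X]} (hB : B.degree < q) (m : ℕ) : ∀ P : ℚ[X],
    (X - C (m : ℚ)) ^ p * P = C w * X ^ q * P.comp (X - 1)
      - (∏ i ∈ range m, (X - C ((i : ℚ) + 1))) ^ p * B → B = 0 := by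
  induction m with
  | zero =>
    intro P h
    simp only [Nat.cast_zero, map_zero, sub_zero, range_zero, prod_empty, one_pow, one_mul] at h
    by_cases hP : P = 0
    · simpa [hP] using h
    exfalso
    have h1 : C w * X ^ q * P.comp (X - 1) = X ^ p * P + B := by rw [h]; ring
    have hdc : (P.comp (X - 1)).natDegree = P.natDegree := by
      rw [natDegree_comp]
      have : (X - 1 : ℚ[X]).natDegree = 1 := by simpa using natDegree_X_sub_C (1 : ℚ)
      rw [this, mul_one]
    have hc0 : P.comp (X - 1) ≠ 0 := by
      intro h0
      apply hP
      have := congrArg (fun R : ℚ[X] ↦ R.comp (X + 1)) h0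
      simpa [comp_assoc] using this
    have hL : (C w * X ^ q * P.comp (X - 1)).degree = ((q + P.natDegree : ℕ) : WithBot ℕ) := by
      rw [degree_mul, degree_C_mul_X_pow q hw, degree_eq_natDegree hc0, hdc]
      rfl
    have hR : (X ^ p * P + B).degree < ((q + P.natDegree : ℕ) : WithBot ℕ) := by
      refine (degree_add_le _ _).trans_lt (max_lt ?_ ?_)
      · rw [degree_mul, degree_X_pow, degree_eq_natDegree hP]
        exact_mod_cast Nat.add_lt_add_right hpq _
      · refine hB.trans_le ?_
        exact_mod_cast Nat.le_add_right _ _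
    rw [h1] at hL
    exact absurd hL hR.ne
  | succ m ih =>
    intro P h
    rw [prod_range_succ, mul_pow] at h
    push_cast at h
    set A : ℚ[X] := X - C ((m : ℚ) + 1) with hA
    have hm : ((m : ℚ) + 1) ≠ 0 := by positivity
    have hcop : IsCoprime (A ^ p) (C w * X ^ q) := by
      refine IsCoprime.mul_right ?_ ?_
      · exact isCoprime_one_right.of_isCoprime_of_dvd_right (isUnit_C.2 hw.isUnit).dvd
      · refine IsCoprime.pow ?_
        have := Polynomial.isCoprime_X_sub_C_of_isUnit_sub (a := (m : ℚ) + 1) (b := 0)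
          (by simpa using hm)
        rwa [C_0, sub_zero] at this
    have hdvd : A ^ p ∣ C w * X ^ q * P.comp (X - 1) := by
      refine ⟨P + (∏ i ∈ range m, (X - C ((i : ℚ) + 1))) ^ p * B, ?_⟩
      linear_combination -h
    obtain ⟨R, hR⟩ := hcop.dvd_of_dvd_mul_left hdvd
    have hAc : A.comp (X + 1) = X - C (m : ℚ) := by simp [hA]
    have hP : P = (X - C (m : ℚ)) ^ p * R.comp (X + 1) := by
      have := congrArg (fun R : ℚ[X] ↦ R.comp (X + 1)) hR
      simpa [comp_assoc, hAc] using this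
    apply ih (R.comp (X + 1))
    have hA0 : A ^ p ≠ 0 := pow_ne_zero _ (X_sub_C_ne_zero _)
    apply mul_left_cancel₀ hA0
    have hRR : (R.comp (X + 1)).comp (X - 1) = R := by simp [comp_assoc]
    rw [hRR, ← hP, h, hR]
    ring

theorem eq_sum_descFactorial_of_recurrence {s : ℕ} {w : ℚ} {b U : ℕ → ℚ}
    (hU : ∀ n : ℕ, U (n + 1) = ((n : ℚ) + 1) ^ s * (w * U n - b n)) (n : ℕ) :
    U n = (n.factorial : ℚ) ^ s * w ^ n * U 0
      - ∑ e ∈ range n, (n.descFactorial (e + 1) : ℚ) ^ s * w ^ e * b (n - 1 - e) := by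
  induction n with
  | zero => simp
  | succ n ih =>
    rw [hU, ih, sum_range_succ']
    have h : ∑ e ∈ range n, ((n + 1).descFactorial (e + 1 + 1) : ℚ) ^ s * w ^ (e + 1)
          * b (n + 1 - 1 - (e + 1)) = ((n : ℚ) + 1) ^ s * w *
        ∑ e ∈ range n, (n.descFactorial (e + 1) : ℚ) ^ s * w ^ e * b (n - 1 - e) := by
      rw [mul_sum]
      refine sum_congr rfl fun e _ ↦ ?_
      rw [Nat.succ_descFactorial_succ, show n + 1 - 1 - (e + 1) = n - 1 - e by lia]
      push_cast
      rw [mul_pow]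
      ring
    rw [h, Nat.factorial_succ]
    simp only [zero_add, Nat.descFactorial_one, add_tsub_cancel_right, tsub_zero]
    push_cast
    rw [mul_pow]
    ring

theorem cast_descFactorial_eq_prod {n k : ℕ} (h : k ≤ n) :
    (n.descFactorial k : ℚ) = ∏ i ∈ range k, ((n : ℚ) - i) := by
  rw [Nat.descFactorial_eq_prod_range, Nat.cast_prod]
  refine prod_congr rfl fun i hi ↦ ?_
  have := mem_range.1 hi
  rw [Nat.cast_sub (by lia)]

theorem natDegree_prod_X_sub_C_le (t : Finset ℕ) :
    (∏ i ∈ t, (X - C (i : ℚ))).natDegree ≤ #t :=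
  (natDegree_finsetProd_X_sub_C_eq_card t (fun i : ℕ ↦ (i : ℚ))).le

theorem exists_eval_eq_choose_pow_mul {s p q m e : ℕ} (hq : s + p = q) (he : e < m)
    {B : ℚ[X]} (hB : B.natDegree < q) :
    ∃ Q : ℚ[X], Q.natDegree < q * m ∧ ∀ n : ℕ, m ≤ n → Q.eval (n : ℚ) =
      (n.choose m : ℚ) ^ p * ((n.descFactorial (e + 1) : ℚ) ^ s *
        (B.eval ((n : ℚ) - e) / ((n : ℚ) - e) ^ q)) := by
  refine ⟨C ((1 / (m.factorial : ℚ)) ^ p) * ((∏ i ∈ (range m).erase e, (X - C (i : ℚ))) ^ p *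
    (∏ i ∈ range e, (X - C (i : ℚ))) ^ s * B.comp (X - C (e : ℚ))), ?_, fun n hn ↦ ?_⟩
  · have h1 := natDegree_prod_X_sub_C_le ((range m).erase e)
    have h2 := natDegree_prod_X_sub_C_le (range e)
    rw [card_erase_of_mem (mem_range.2 he), card_range] at h1
    rw [card_range] at h2
    have h3 : (B.comp (X - C (e : ℚ))).natDegree = B.natDegree := by
      rw [natDegree_comp, natDegree_X_sub_C, mul_one]
    refine (natDegree_C_mul_le _ _).trans_lt ?_
    refine (natDegree_mul_le.trans (Nat.add_le_add_right natDegree_mul_le _)).trans_lt ?_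
    rw [h3]
    have h4 := natDegree_pow_le_of_le p h1
    have h5 := natDegree_pow_le_of_le s (h2.trans (Nat.le_sub_one_of_lt he))
    obtain ⟨k, rfl⟩ : ∃ k, m = k + 1 := ⟨m - 1, by lia⟩
    simp only [Nat.add_sub_cancel] at h4 h5
    have : q * (k + 1) = p * k + s * k + q := by rw [← hq]; ring
    rw [this]
    lia
  · have hne : ((n : ℚ) - e) ≠ 0 := by
      have : (e : ℚ) < n := by exact_mod_cast he.trans_le hn
      exact (sub_pos.2 this).ne'
    have hfac : (m.factorial : ℚ) ≠ 0 := by positivity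
    have hch : (n.choose m : ℚ) =
        (1 / (m.factorial : ℚ)) * (((n : ℚ) - e) * ∏ i ∈ (range m).erase e, ((n : ℚ) - i)) := by
      rw [mul_prod_erase _ (fun i : ℕ ↦ (n : ℚ) - i) (mem_range.2 he),
        ← cast_descFactorial_eq_prod hn, Nat.descFactorial_eq_factorial_mul_choose]
      push_cast
      field_simp
    rw [hch, cast_descFactorial_eq_prod (by lia : e + 1 ≤ n), prod_range_succ, ← hq]
    simp only [eval_mul, eval_C, eval_pow, eval_prod, eval_sub, eval_X, eval_comp]
    simp only [mul_pow, pow_add]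
    field_simp

theorem dvd_lcmUpto {k n : ℕ} (hk : k ≠ 0) (hkn : k ≤ n) : k ∣ Nat.lcmUpto n := by
  exact Finset.dvd_lcm (f := id) (mem_Icc.2 ⟨Nat.one_le_iff_ne_zero.2 hk, hkn⟩)

theorem exists_lcmUpto_le : ∃ K : ℕ, ∀ n, Nat.lcmUpto n ≤ K ^ n := by
  refine ⟨⌈Real.exp (Real.log 4 + 4)⌉₊, fun n ↦ ?_⟩
  have h := Chebyshev.psi_le_const_mul_self (Nat.cast_nonneg (α := ℝ) n)
  rw [Chebyshev.psi_eq_log_lcmUpto, Real.log_le_iff_le_exp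
    (by exact_mod_cast Nat.lcmUpto_pos n), mul_comm, Real.exp_nat_mul] at h
  have h2 : (Nat.lcmUpto n : ℝ) ≤ (⌈Real.exp (Real.log 4 + 4)⌉₊ : ℝ) ^ n :=
    h.trans (pow_le_pow_left₀ (Real.exp_pos _).le (Nat.le_ceil _) n)
  exact_mod_cast h2

theorem exists_den_pow_mul_pow_eq (w : ℚ) {k N : ℕ} (h : k ≤ N) :
    ∃ y : ℤ, (w.den : ℚ) ^ N * w ^ k = y := by
  refine ⟨w.den ^ (N - k) * w.num ^ k, ?_⟩
  have := Rat.mul_den_eq_num w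
  push_cast
  rw [← this, mul_pow, ← Nat.sub_add_cancel h, pow_add, Nat.add_sub_cancel]
  ring

theorem exists_lcmUpto_pow_mul_div_eq (q : ℕ) {k N : ℕ} (hk : k ≠ 0) (h : k ≤ N) (b : ℤ) :
    ∃ y : ℤ, (Nat.lcmUpto N : ℚ) ^ q * (b / (k : ℚ) ^ q) = y := by
  obtain ⟨c, hc⟩ := dvd_lcmUpto hk h
  refine ⟨c ^ q * b, ?_⟩
  have : (k : ℚ) ≠ 0 := by exact_mod_cast hk
  rw [hc]
  push_cast
  rw [mul_pow]
  field_simp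

theorem exists_polynomial_approx {s p q : ℕ} (hq : s + p = q) (hs : 1 ≤ s) {w : ℚ} {u : ℤ}
    {B : ℤ[X]} (hB : B.natDegree < q) {U : ℕ → ℚ} (h0 : U 0 = u)
    (hU : ∀ n : ℕ, U (n + 1) = ((n : ℚ) + 1) ^ s *
      (w * U n - ((B.eval ((n : ℤ) + 1) : ℤ) : ℚ) / ((n : ℚ) + 1) ^ q)) {m : ℕ} (hm : 1 ≤ m) :
    ∃ Q : ℚ[X], Q.natDegree < q * m ∧ ∀ N n, m ≤ n → n ≤ N → ∃ y : ℤ,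
      (w.den : ℚ) ^ N * (Nat.lcmUpto N : ℚ) ^ q * ((n.choose m : ℚ) ^ p * U n - Q.eval (n : ℚ)) =
        y * (m.factorial : ℚ) ^ s := by
  have hBQ : (B.map (Int.castRingHom ℚ)).natDegree < q := natDegree_map_le.trans_lt hB
  choose! Q hQd hQ using fun e (he : e < m) ↦ exists_eval_eq_choose_pow_mul hq he hBQ
  refine ⟨-∑ e ∈ range m, C (w ^ e) * Q e, ?_, fun N n hmn hnN ↦ ?_⟩
  · rw [natDegree_neg]
    have hpos : 0 < q * m := Nat.mul_pos (by lia) hm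
    have : (∑ e ∈ range m, C (w ^ e) * Q e).natDegree ≤ q * m - 1 := by
      refine natDegree_sum_le_of_forall_le _ _ fun e he ↦ ?_
      have := hQd e (mem_range.1 he)
      exact (natDegree_C_mul_le _ _).trans (by lia)
    lia
  set b : ℕ → ℚ := fun n ↦ ((B.eval ((n : ℤ) + 1) : ℤ) : ℚ) / ((n : ℚ) + 1) ^ q with hb
  have hexp := eq_sum_descFactorial_of_recurrence (b := b) hU n
  have hbe : ∀ e < n, b (n - 1 - e) = (B.map (Int.castRingHom ℚ)).eval ((n : ℚ) - e) /
      ((n : ℚ) - e) ^ q := by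
    intro e he
    have h1 : (((n - 1 - e : ℕ) : ℤ) + 1) = (n : ℤ) - e := by lia
    have h2 : (((n - 1 - e : ℕ) : ℚ) + 1) = (n : ℚ) - e := by exact_mod_cast h1
    have h3 : ((n : ℚ) - e) = (Int.castRingHom ℚ) ((n : ℤ) - e) := by simp
    simp only [hb]
    rw [h1, h2, h3, eval_map, eval₂_at_apply]
    simp
  rw [← sum_range_add_sum_Ico _ hmn] at hexp
  have hlow : ∑ e ∈ range m, w ^ e * (Q e).eval (n : ℚ) = (n.choose m : ℚ) ^ p *
      ∑ e ∈ range m, (n.descFactorial (e + 1) : ℚ) ^ s * w ^ e * b (n - 1 - e) := by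
    rw [mul_sum]
    refine sum_congr rfl fun e he ↦ ?_
    have he' := mem_range.1 he
    rw [hQ e he' n hmn, hbe e (he'.trans_le hmn)]
    ring
  have key : (w.den : ℚ) ^ N * (Nat.lcmUpto N : ℚ) ^ q * ((n.choose m : ℚ) ^ p * U n -
      (-∑ e ∈ range m, C (w ^ e) * Q e : ℚ[X]).eval (n : ℚ)) =
      (w.den : ℚ) ^ N * (Nat.lcmUpto N : ℚ) ^ q * (n.choose m : ℚ) ^ p *
        ((n.factorial : ℚ) ^ s * w ^ n * u) -
      ∑ e ∈ Ico m n, (w.den : ℚ) ^ N * (Nat.lcmUpto N : ℚ) ^ q * (n.choose m : ℚ) ^ p *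
        ((n.descFactorial (e + 1) : ℚ) ^ s * w ^ e * b (n - 1 - e)) := by
    rw [← mul_sum, hexp, h0]
    simp only [eval_neg, eval_finsetSum, eval_mul, eval_C]
    rw [hlow]
    ring
  rw [key]
  suffices h : ∀ x ∈ AddSubgroup.zmultiples ((m.factorial : ℚ) ^ s),
      ∃ y : ℤ, x = y * (m.factorial : ℚ) ^ s by
    refine h _ (AddSubgroup.sub_mem _ ?_ (AddSubgroup.sum_mem _ fun e he ↦ ?_))
    · obtain ⟨c, hc⟩ := Nat.factorial_dvd_factorial hmn
      obtain ⟨y, hy⟩ := exists_den_pow_mul_pow_eq w hnN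
      refine AddSubgroup.mem_zmultiples_iff.2
        ⟨y * (Nat.lcmUpto N : ℤ) ^ q * (n.choose m : ℤ) ^ p * (c : ℤ) ^ s * u, ?_⟩
      rw [zsmul_eq_mul, hc]
      push_cast
      rw [← hy, mul_pow (m.factorial : ℚ)]
      ring
    · obtain ⟨he1, he2⟩ := mem_Ico.1 he
      obtain ⟨c, hc⟩ : m.factorial ∣ n.descFactorial (e + 1) :=
        (Nat.factorial_dvd_factorial (by lia)).trans (Nat.factorial_dvd_descFactorial n (e + 1))
      obtain ⟨y, hy⟩ := exists_den_pow_mul_pow_eq w (by lia : e ≤ N)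
      obtain ⟨x, hx⟩ := exists_lcmUpto_pow_mul_div_eq q (by lia : n - 1 - e + 1 ≠ 0)
        (by lia : n - 1 - e + 1 ≤ N) (B.eval (((n - 1 - e : ℕ) : ℤ) + 1))
      push_cast at hx
      refine AddSubgroup.mem_zmultiples_iff.2 ⟨y * x * (n.choose m : ℤ) ^ p * (c : ℤ) ^ s, ?_⟩
      rw [zsmul_eq_mul, hc]
      push_cast
      rw [← hy, ← hx, mul_pow (m.factorial : ℚ)]
      ring
  intro x hx
  obtain ⟨y, rfl⟩ := AddSubgroup.mem_zmultiples_iff.1 hx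
  exact ⟨y, zsmul_eq_mul _ _⟩

theorem exists_mul_pow_lt_factorial (M G : ℕ) : ∃ m : ℕ, 1 ≤ m ∧ M * G ^ m < m.factorial := by
  have h := (FloorSemiring.tendsto_pow_div_factorial_atTop (G : ℝ)).const_mul (M : ℝ)
  rw [mul_zero] at h
  obtain ⟨m, hm, hm1⟩ := ((h.eventually (gt_mem_nhds one_pos)).and
    (Filter.eventually_ge_atTop 1)).exists
  refine ⟨m, hm1, ?_⟩
  rw [← mul_div_assoc, div_lt_one (by positivity)] at hm
  exact_mod_cast hm

theorem eq_zero_of_bounded_recurrence {s p q : ℕ} (hq : s + p = q) (hs : 1 ≤ s) {w : ℚ}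
    (hw : w ≠ 0) {u : ℤ} {B : ℤ[X]} (hB : B.natDegree < q) {U : ℕ → ℚ} (h0 : U 0 = u)
    (hU : ∀ n : ℕ, U (n + 1) = ((n : ℚ) + 1) ^ s *
      (w * U n - ((B.eval ((n : ℤ) + 1) : ℤ) : ℚ) / ((n : ℚ) + 1) ^ q))
    {M : ℕ} (hM : ∀ n, |U n| ≤ M) : B = 0 := by
  obtain ⟨K, hK⟩ := exists_lcmUpto_le
  obtain ⟨m, hm, hfac⟩ := exists_mul_pow_lt_factorial M
    (w.den ^ (2 * q + 1) * (K ^ (2 * q + 1)) ^ q * 2 ^ q * (2 ^ (2 * q + 1)) ^ p)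
  set N := (2 * q + 1) * m with hN
  obtain ⟨Q, hQd, hQ⟩ := exists_polynomial_approx hq hs hB h0 hU hm
  have hqm : q ≤ q * m := Nat.le_mul_of_pos_right q hm
  have hN' : N = q * m + q * m + m := by rw [hN]; ring
  set f : ℕ → ℚ := fun n ↦ (n.choose m : ℚ) ^ p * U n with hf
  set D : ℚ := (w.den : ℚ) ^ N * (Nat.lcmUpto N : ℚ) ^ q with hD
  have hDpos : 0 < D := by
    have h1 : (0 : ℚ) < w.den := by exact_mod_cast w.den_pos
    have h2 : (0 : ℚ) < Nat.lcmUpto N := by exact_mod_cast Nat.lcmUpto_pos N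
    positivity
  have hvanish : ∀ t ≤ q, ∑ i ∈ range (q * m + 1),
      (-1 : ℚ) ^ (q * m - i) * (q * m).choose i * f (m + t + i) = 0 := by
    intro t ht
    set W := ∑ i ∈ range (q * m + 1),
      (-1 : ℚ) ^ (q * m - i) * (q * m).choose i * f (m + t + i) with hW
    have hle : ∀ i ∈ range (q * m + 1), m + t + i ≤ N := fun i hi ↦ by
      have := mem_range.1 hi
      lia
    have hint : ∃ Y : ℤ, D * W = Y * (m.factorial : ℚ) ^ s := by
      choose! y hy using fun n (hn : m ≤ n) (hnN : n ≤ N) ↦ hQ N n hn hnN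
      refine ⟨∑ i ∈ range (q * m + 1), (-1) ^ (q * m - i) * (q * m).choose i * y (m + t + i), ?_⟩
      have h1 := sum_neg_one_pow_choose_eval_eq_zero hQd (m + t)
      rw [← sub_zero W, ← h1, hW, ← sum_sub_distrib, mul_sum]
      push_cast
      rw [sum_mul]
      refine sum_congr rfl fun i hi ↦ ?_
      rw [mul_assoc _ (y (m + t + i) : ℚ), ← hy (m + t + i) (by lia) (hle i hi)]
      push_cast
      ring
    have hWle : |W| ≤ 2 ^ (q * m) * ((2 ^ N) ^ p * M) := by
      refine (abs_sum_le_sum_abs _ _).trans ?_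
      have h2 : ((2 : ℚ) ^ (q * m)) = ∑ i ∈ range (q * m + 1), ((q * m).choose i : ℚ) := by
        exact_mod_cast (Nat.sum_range_choose (q * m)).symm
      rw [h2, sum_mul]
      refine sum_le_sum fun i hi ↦ ?_
      rw [abs_mul, abs_mul, abs_pow, abs_neg, abs_one, one_pow, one_mul, Nat.abs_cast, hf, abs_mul,
        abs_pow, Nat.abs_cast]
      have h3 : ((m + t + i).choose m : ℚ) ≤ 2 ^ N := by
        exact_mod_cast (Nat.choose_le_two_pow _ _).trans
          (Nat.pow_le_pow_right two_pos (hle i hi))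
      have h4 := hM (m + t + i)
      gcongr
    have hDle : D ≤ (w.den : ℚ) ^ N * (K ^ N) ^ q := by
      have h3 : (Nat.lcmUpto N : ℚ) ≤ K ^ N := by exact_mod_cast hK N
      rw [hD]
      gcongr
    have hlt : |D * W| < (m.factorial : ℚ) ^ s := by
      rw [abs_mul, abs_of_pos hDpos]
      refine (mul_le_mul hDle hWle (abs_nonneg _) (by positivity)).trans_lt ?_
      have h5 : (M : ℚ) * ((w.den : ℚ) ^ (2 * q + 1) * (K ^ (2 * q + 1)) ^ q * 2 ^ q *
          (2 ^ (2 * q + 1)) ^ p) ^ m < m.factorial := by exact_mod_cast hfac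
      have h6 : (m.factorial : ℚ) ≤ (m.factorial : ℚ) ^ s :=
        le_self_pow₀ (by exact_mod_cast m.factorial_pos) (by lia)
      refine lt_of_eq_of_lt ?_ (h5.trans_le h6)
      rw [hN]
      ring
    obtain ⟨Y, hY⟩ := hint
    have hfs : (0 : ℚ) < (m.factorial : ℚ) ^ s := by positivity
    rw [hY, abs_mul, abs_of_pos hfs] at hlt
    have hY1 : |(Y : ℚ)| < 1 := lt_of_mul_lt_mul_right (by rwa [one_mul]) hfs.le
    have hY0 : Y = 0 := Int.abs_lt_one_iff.1 (by exact_mod_cast hY1)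
    rw [hY0, Int.cast_zero, zero_mul] at hY
    exact (mul_eq_zero.1 hY).resolve_left hDpos.ne'
  obtain ⟨P, hPd, hP⟩ := exists_eval_eq_of_sum_choose_eq_zero hvanish
  set B' : ℚ[X] := C ((1 / (m.factorial : ℚ)) ^ p) * B.map (Int.castRingHom ℚ) with hB'
  have hfac0 : (m.factorial : ℚ) ≠ 0 := by positivity
  have hB'd : B'.degree < q := by
    refine (degree_C_mul_of_isUnit ?_ _).trans_lt ?_
    · exact (pow_ne_zero p (one_div_ne_zero hfac0)).isUnit
    · refine degree_map_le.trans_lt (degree_le_natDegree.trans_lt ?_)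
      exact_mod_cast hB
  have hzero : B' = 0 := by
    refine eq_zero_of_polynomial_recurrence (by lia : p < q) hw hB'd m P ?_
    have hinj : Set.InjOn (fun k : ℕ ↦ ((m + (k + 1) : ℕ) : ℚ)) (range (q * m + q)) :=
      Function.Injective.injOn fun x y hxy ↦ by simpa using hxy
    refine eq_of_degree_sub_lt_of_eval_index_eq _ hinj ?_ ?_
    · have hPn : P.natDegree < q * m := by
        rcases eq_or_ne P 0 with rfl | hP0
        · rw [natDegree_zero]
          lia
        · exact (natDegree_lt_iff_degree_lt hP0).2 hPd
      have hPc : (P.comp (X - 1)).natDegree = P.natDegree := by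
        rw [natDegree_comp, ← C_1, natDegree_X_sub_C, mul_one]
      have hprod : (∏ i ∈ range m, (X - C ((i : ℚ) + 1))).natDegree = m := by
        rw [natDegree_finsetProd_X_sub_C_eq_card, card_range]
      have hBn : B'.natDegree < q :=
        (natDegree_C_mul_le _ _).trans_lt (natDegree_map_le.trans_lt hB)
      have h1 : ((X - C (m : ℚ)) ^ p * P).natDegree < q * m + q := by
        refine natDegree_mul_le.trans_lt ?_
        rw [natDegree_pow, natDegree_X_sub_C]
        lia
      have h2 : (C w * X ^ q * P.comp (X - 1)).natDegree < q * m + q := by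
        refine natDegree_mul_le.trans_lt ?_
        rw [hPc, natDegree_C_mul_X_pow q w hw]
        lia
      have h3 : ((∏ i ∈ range m, (X - C ((i : ℚ) + 1))) ^ p * B').natDegree < q * m + q := by
        refine natDegree_mul_le.trans_lt ?_
        rw [natDegree_pow, hprod]
        have : p * m ≤ q * m := Nat.mul_le_mul_right m (by lia)
        lia
      rw [card_range]
      exact (degree_sub_le _ _).trans_lt (max_lt
        (degree_le_natDegree.trans_lt (by exact_mod_cast h1))
        ((degree_sub_le _ _).trans_lt (max_lt
          (degree_le_natDegree.trans_lt (by exact_mod_cast h2))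
          (degree_le_natDegree.trans_lt (by exact_mod_cast h3)))))
    · intro k hk
      have hk' := mem_range.1 hk
      have e1 := hP (k + 1) (by lia)
      have e2 := hP k (by lia)
      simp only [eval_mul, eval_sub, eval_pow, eval_X, eval_C, eval_comp, eval_prod, eval_one]
      rw [e1, show (((m + (k + 1) : ℕ) : ℚ) - 1) = ((m + k : ℕ) : ℚ) by push_cast; ring, e2]
      have e3 : (∏ i ∈ range m, (((m + (k + 1) : ℕ) : ℚ) - ((i : ℚ) + 1))) =
          m.factorial * ((m + k).choose m : ℚ) := by
        rw [← Nat.cast_mul, ← Nat.descFactorial_eq_factorial_mul_choose,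
          cast_descFactorial_eq_prod (by lia)]
        refine prod_congr rfl fun i _ ↦ ?_
        push_cast
        ring
      have e4 : (((m + (k + 1) : ℕ) : ℚ) - m) * ((m + (k + 1)).choose m : ℚ) =
          ((m + (k + 1) : ℕ) : ℚ) * ((m + k).choose m : ℚ) := by
        have := Nat.choose_mul_succ_eq (m + k) m
        rw [show m + k + 1 - m = k + 1 by lia] at this
        have h' : ((m + k).choose m : ℚ) * (m + k + 1) = ((m + k + 1).choose m : ℚ) * (k + 1) := by
          exact_mod_cast this
        rw [← add_assoc]
        push_cast
        linear_combination -h'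
      have e5 : (B.map (Int.castRingHom ℚ)).eval ((m + (k + 1) : ℕ) : ℚ) =
          ((B.eval (((m + k : ℕ) : ℤ) + 1) : ℤ) : ℚ) := by
        have : ((m + (k + 1) : ℕ) : ℚ) = (Int.castRingHom ℚ) (((m + k : ℕ) : ℤ) + 1) := by
          push_cast [eq_intCast]
          ring
        rw [this, eval_map, eval₂_at_apply, eq_intCast]
      have e6 := hU (m + k)
      have e7 : (((m + k : ℕ) : ℚ) + 1) = ((m + (k + 1) : ℕ) : ℚ) := by push_cast; ring
      have e8 : ((m + (k + 1) : ℕ) : ℚ) ≠ 0 := by positivity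
      rw [hB', eval_mul, eval_C, e5, e3]
      simp only [hf]
      rw [← mul_assoc, ← mul_pow, e4, ← add_assoc m k 1, e6, add_assoc m k 1, e7, ← hq]
      simp only [mul_pow, pow_add, one_div, inv_pow]
      field_simp
  have hmap : B.map (Int.castRingHom ℚ) = 0 :=
    (mul_eq_zero.1 hzero).resolve_left (C_ne_zero.2 (pow_ne_zero p (one_div_ne_zero hfac0)))
  exact (Polynomial.map_eq_zero_iff (Int.castRingHom ℚ).injective_int).1 hmap

theorem exists_nat_mul_eq_int (S : Finset ℚ) :
    ∃ A : ℕ, A ≠ 0 ∧ ∀ x ∈ S, ∃ y : ℤ, (A : ℚ) * x = y := by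
  refine ⟨∏ x ∈ S, x.den, prod_ne_zero_iff.2 fun x _ ↦ x.den_nz, fun x hx ↦ ?_⟩
  obtain ⟨c, hc⟩ := dvd_prod_of_mem (fun x : ℚ ↦ x.den) hx
  refine ⟨c * x.num, ?_⟩
  rw [hc]
  push_cast
  rw [← Rat.mul_den_eq_num x]
  ring

theorem factorial_pow_div_factorial_pow_le {s : ℕ} (hs : 1 ≤ s) (k n : ℕ) :
    (n.factorial : ℝ) ^ s / ((k + n).factorial : ℝ) ^ s ≤ 1 / (k.factorial : ℝ) := by
  have h1 : (n.factorial : ℝ) / ((k + n).factorial : ℝ) ≤ 1 / (k.factorial : ℝ) := by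
    rw [div_le_div_iff₀ (by positivity) (by positivity), one_mul, mul_comm]
    exact_mod_cast Nat.le_of_dvd (Nat.factorial_pos _)
      (Nat.factorial_mul_factorial_dvd_factorial_add k n)
  have h2 : (n.factorial : ℝ) / ((k + n).factorial : ℝ) ≤ 1 := by
    rw [div_le_one (by positivity)]
    exact_mod_cast Nat.factorial_le (Nat.le_add_left n k)
  rw [← div_pow]
  exact (pow_le_of_le_one (by positivity) h2 (by lia)).trans h1

theorem exists_nat_bound_of_recurrence {s : ℕ} (hs : 1 ≤ s) {z : ℚ} (hz : z ≠ 0) {ρ U : ℕ → ℚ}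
    {R : ℝ} (hρ : ∀ k, |(ρ k : ℝ)| ≤ R)
    (hU : ∀ n : ℕ, U (n + 1) = ((n : ℚ) + 1) ^ s * (z⁻¹ * U n - ρ n))
    (h0 : (U 0 : ℝ) = z * ∑' k : ℕ, (z : ℝ) ^ k * ρ k / (k.factorial : ℝ) ^ s) :
    ∃ M : ℕ, ∀ n, |U n| ≤ M := by
  have hz' : (z : ℝ) ≠ 0 := by exact_mod_cast hz
  have hexp := Real.summable_pow_div_factorial |(z : ℝ)|
  have hb : ∀ n k : ℕ, ‖(n.factorial : ℝ) ^ s * ((z : ℝ) ^ k * ρ (k + n) /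
      ((k + n).factorial : ℝ) ^ s)‖ ≤ R * (|(z : ℝ)| ^ k / k.factorial) := by
    intro n k
    rw [Real.norm_eq_abs, show (n.factorial : ℝ) ^ s * ((z : ℝ) ^ k * ρ (k + n) /
      ((k + n).factorial : ℝ) ^ s) = ρ (k + n) * ((z : ℝ) ^ k *
        ((n.factorial : ℝ) ^ s / ((k + n).factorial : ℝ) ^ s)) by ring, abs_mul, abs_mul, abs_pow,
      abs_of_nonneg (a := (n.factorial : ℝ) ^ s / ((k + n).factorial : ℝ) ^ s) (by positivity),
      div_eq_mul_one_div (|(z : ℝ)| ^ k)]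
    have h1 := factorial_pow_div_factorial_pow_le hs k n
    have h2 := hρ (k + n)
    have h3 : 0 ≤ R := (abs_nonneg _).trans h2
    gcongr
  have hsum : Summable fun k : ℕ ↦ (z : ℝ) ^ k * ρ k / (k.factorial : ℝ) ^ s := by
    refine Summable.of_norm_bounded (hexp.mul_left R) fun k ↦ ?_
    simpa using hb 0 k
  have hform : ∀ n, (U n : ℝ) = z * ∑' k : ℕ, (n.factorial : ℝ) ^ s *
      ((z : ℝ) ^ k * ρ (k + n) / ((k + n).factorial : ℝ) ^ s) := by
    intro n
    induction n with
    | zero => simpa using h0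
    | succ n ih =>
      have hs' : Summable fun k : ℕ ↦ (n.factorial : ℝ) ^ s *
          ((z : ℝ) ^ k * ρ (k + n) / ((k + n).factorial : ℝ) ^ s) :=
        Summable.of_norm_bounded (hexp.mul_left R) (hb n)
      rw [hU]
      push_cast
      rw [ih, hs'.tsum_eq_zero_add, inv_mul_cancel_left₀ hz', ← tsum_mul_left]
      have hfac : (n.factorial : ℝ) ≠ 0 := by positivity
      simp only [zero_add, pow_zero, one_mul]
      rw [mul_div_cancel₀ _ (pow_ne_zero s hfac), add_sub_cancel_left, ← tsum_mul_left]
      refine tsum_congr fun k ↦ ?_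
      rw [show k + 1 + n = k + (n + 1) by ring, Nat.factorial_succ n]
      push_cast
      rw [mul_pow]
      ring
  obtain ⟨M, hM⟩ := exists_nat_ge (|(z : ℝ)| * (R * ∑' k : ℕ, |(z : ℝ)| ^ k / k.factorial))
  refine ⟨M, fun n ↦ ?_⟩
  have h1 := tsum_of_norm_bounded (hexp.hasSum.mul_left R) (hb n)
  have h2 : |(U n : ℝ)| ≤ M := by
    rw [hform, abs_mul]
    exact (mul_le_mul_of_nonneg_left h1 (abs_nonneg _)).trans hM
  exact_mod_cast h2

/-- ℚ-linear independence of `1` and the constants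
`T_j = ∑_{k≥0} z^k / ((k+1)^j (k!)^{q-p})` for `j = 1, …, q`, where `0 ≤ p < q` and
`z ∈ ℚ`, `z ≠ 0`; in particular each `T_j` is irrational. -/
theorem stmt_17
    (p q : ℕ) (hpq : p < q)
    (z : ℚ) (hz : z ≠ 0)
    (T : Fin q → ℝ)
    (hT : ∀ j, T j = ∑' k : ℕ,
      (z : ℝ) ^ k / (((k : ℝ) + 1) ^ ((j : ℕ) + 1) * ((k.factorial : ℝ)) ^ (q - p))) :
    ∀ (c0 : ℚ) (c : Fin q → ℚ),
      (c0 : ℝ) + ∑ j, (c j : ℝ) * T j = 0 → c0 = 0 ∧ ∀ j, c j = 0 := by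
  intro c0 c hrel
  set s := q - p
  have hs : 1 ≤ s := by lia
  obtain ⟨A, hA, hAint⟩ := exists_nat_mul_eq_int (insert (-(z * c0)) (univ.image c))
  obtain ⟨u, hu⟩ := hAint _ (mem_insert_self _ _)
  choose b hb using fun j ↦ hAint (c j) (mem_insert_of_mem (mem_image_of_mem c (mem_univ j)))
  have hA' : (A : ℚ) ≠ 0 := by exact_mod_cast hA
  set B : ℤ[X] := ∑ j : Fin q, C (b j) * X ^ (q - 1 - j) with hB
  have hBd : B.natDegree < q := by
    have : B.natDegree ≤ q - 1 := natDegree_sum_le_of_forall_le _ _ fun j _ ↦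
      (natDegree_C_mul_X_pow_le _ _).trans (Nat.sub_le _ _)
    lia
  set ρ : ℕ → ℚ := fun n ↦ ((B.eval ((n : ℤ) + 1) : ℤ) : ℚ) / ((n : ℚ) + 1) ^ q with hρ
  have hρ' : ∀ n : ℕ, (ρ n : ℝ) = ∑ j : Fin q, (b j : ℝ) / ((n : ℝ) + 1) ^ ((j : ℕ) + 1) := by
    intro n
    simp only [hρ, hB, eval_finsetSum, eval_mul, eval_C, eval_pow, eval_X]
    push_cast
    rw [sum_div]
    refine sum_congr rfl fun j _ ↦ ?_
    have hn : ((n : ℝ) + 1) ≠ 0 := by positivity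
    rw [div_eq_div_iff (by positivity) (by positivity), mul_assoc, ← pow_add]
    congr 2
    lia
  have hρb : ∀ n, |(ρ n : ℝ)| ≤ ∑ j : Fin q, |(b j : ℝ)| := by
    intro n
    rw [hρ']
    refine (abs_sum_le_sum_abs _ _).trans (sum_le_sum fun j _ ↦ ?_)
    have h1 : (1 : ℝ) ≤ ((n : ℝ) + 1) ^ ((j : ℕ) + 1) := one_le_pow₀ (by simp)
    rw [abs_div, abs_of_pos (zero_lt_one.trans_le h1)]
    exact div_le_self (abs_nonneg _) h1
  have hsum : ∀ j : Fin q, Summable fun k : ℕ ↦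
      (z : ℝ) ^ k / (((k : ℝ) + 1) ^ ((j : ℕ) + 1) * ((k.factorial : ℝ)) ^ s) := by
    intro j
    refine Summable.of_norm_bounded (Real.summable_pow_div_factorial |(z : ℝ)|) fun k ↦ ?_
    have h1 : (1 : ℝ) ≤ ((k : ℝ) + 1) ^ ((j : ℕ) + 1) := one_le_pow₀ (by simp)
    have h2 : (1 : ℝ) ≤ k.factorial := by exact_mod_cast k.factorial_pos
    have h3 : (k.factorial : ℝ) ≤ (k.factorial : ℝ) ^ s := le_self_pow₀ h2 (by lia)
    have h4 : (k.factorial : ℝ) ≤ ((k : ℝ) + 1) ^ ((j : ℕ) + 1) * (k.factorial : ℝ) ^ s :=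
      h3.trans (le_mul_of_one_le_left (by positivity) h1)
    rw [Real.norm_eq_abs, abs_div, abs_pow,
      abs_of_pos (a := ((k : ℝ) + 1) ^ ((j : ℕ) + 1) * (k.factorial : ℝ) ^ s) (by positivity)]
    gcongr
  have htsum : ∑' k : ℕ, (z : ℝ) ^ k * ρ k / (k.factorial : ℝ) ^ s = ∑ j, (b j : ℝ) * T j := by
    simp only [hT, ← tsum_mul_left]
    rw [← Summable.tsum_finsetSum fun j _ ↦ (hsum j).mul_left _]
    refine tsum_congr fun k ↦ ?_
    rw [hρ', mul_sum, sum_div]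
    refine sum_congr rfl fun j _ ↦ ?_
    field_simp
  have hbT : ∑ j, (b j : ℝ) * T j = -(A * c0) := by
    have hbR : ∀ j, (b j : ℝ) = A * c j := fun j ↦ by exact_mod_cast (hb j).symm
    simp only [hbR, mul_assoc, ← mul_sum]
    linear_combination (A : ℝ) * hrel
  let U : ℕ → ℚ := fun n ↦ Nat.rec (u : ℚ) (fun n x ↦ ((n : ℚ) + 1) ^ s * (z⁻¹ * x - ρ n)) n
  have hU : ∀ n : ℕ, U (n + 1) = ((n : ℚ) + 1) ^ s * (z⁻¹ * U n - ρ n) := fun _ ↦ rfl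
  have hU0 : U 0 = u := rfl
  obtain ⟨M, hM⟩ := exists_nat_bound_of_recurrence hs hz hρb hU (by
    rw [htsum, hbT, hU0, ← hu]
    push_cast
    ring)
  have hB0 := eq_zero_of_bounded_recurrence (by lia : s + p = q) hs (inv_ne_zero hz) hBd hU0 hU hM
  have hbz : ∀ j, b j = 0 := by
    intro j
    have h := congrArg (fun P : ℤ[X] ↦ P.coeff (q - 1 - j)) hB0
    simp only [hB, finsetSum_coeff, coeff_C_mul_X_pow, coeff_zero] at h
    rw [sum_eq_single j (fun i _ hij ↦ if_neg fun h' ↦ hij (Fin.ext (by lia))) (by simp)] at h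
    simpa using h
  have hc : ∀ j, c j = 0 := by
    intro j
    have := hb j
    rw [hbz j, Int.cast_zero] at this
    exact (mul_eq_zero.1 this).resolve_left hA'
  refine ⟨?_, hc⟩
  simpa [hc] using hrel
end
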